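/- arXiv:math/0404115 — 2 statements merged into one kernel-verified Lean document; each statement's English description precedes it below -/
import Mathlib

section
/- Let φ : H → G be a homomorphism of finitely generated amenable groups whose image has finite index n = [G : φ(H)] and whose kernel is finite with k = |ker φ| elements. Then φ is a bounded distance from a bijection (with respect to the word metric on G) if and only if n = k. -/
open Filter

/-- The word length of `g` with respect to a generating set `S`: the least `n` such that `g`
is a product of `n` elements of `S ∪ S⁻¹`. -/
noncomputable def wordLength {G : Type*} [Group G] (S : Set G) (g : G) : ℕ :=
  sInf {n : ℕ | ∃ w : List G, w.length = n ∧ (∀ x ∈ w, x ∈ S ∨ x⁻¹ ∈ S) ∧ w.prod = g}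

/-- The word metric `d(x,y) = ‖x⁻¹y‖` with respect to the generating set `S`. -/
noncomputable def wordDist {G : Type*} [Group G] (S : Set G) (x y : G) : ℝ :=
  (wordLength S (x⁻¹ * y) : ℝ)

/-- Distance from a point to a set in the word metric. -/
noncomputable def setDist {G : Type*} [Group G] (S : Set G) (x : G) (A : Set G) : ℝ :=
  sInf ((fun a => wordDist S x a) '' A)

/-- The boundary `∂A = {x ∈ G : 0 < d(x,A) ≤ 1}`. -/
def wordBoundary {G : Type*} [Group G] (S : Set G) (A : Set G) : Set G :=
  {x : G | 0 < setDist S x A ∧ setDist S x A ≤ 1}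

/-- A Folner sequence: nonempty finite subsets `F i` with `|∂F i| / |F i| → 0`. -/
def IsFolner {G : Type*} [Group G] (S : Set G) (F : ℕ → Finset G) : Prop :=
  (∀ i, (F i).Nonempty) ∧
  Filter.Tendsto
    (fun i => ((wordBoundary S ((F i : Set G))).ncard : ℝ) / ((F i).card : ℝ))
    Filter.atTop (nhds 0)

/-- A `(K,C)` quasi-isometry between spaces with distance functions `dX`, `dY`:
`-C + dX x x' / K ≤ dY (f x) (f x') ≤ K * dX x x' + C`, and the image is `C`-dense. -/
def IsQuasiIsometry {X Y : Type*} (dX : X → X → ℝ) (dY : Y → Y → ℝ) (f : X → Y) : Prop :=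
  ∃ K C : ℝ, 1 ≤ K ∧ 0 ≤ C ∧
    (∀ x x' : X, -C + dX x x' / K ≤ dY (f x) (f x') ∧ dY (f x) (f x') ≤ K * dX x x' + C) ∧
    (∀ y : Y, ∃ x : X, dY (f x) y ≤ C)


open scoped Pointwise

lemma wl_set_nonempty {G : Type*} [Group G] {S : Set G} (hS : Subgroup.closure S = ⊤) (g : G) :
    {n : ℕ | ∃ w : List G, w.length = n ∧ (∀ x ∈ w, x ∈ S ∨ x⁻¹ ∈ S) ∧ w.prod = g}.Nonempty := by
  have hg : g ∈ Subgroup.closure S := by rw [hS]; trivial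
  rw [← Subgroup.mem_toSubmonoid, Subgroup.closure_toSubmonoid] at hg
  obtain ⟨l, hl, hp⟩ := Submonoid.exists_list_of_mem_closure hg
  exact ⟨l.length, l, rfl, fun x hx => by simpa using hl x hx, hp⟩

lemma wl_spec {G : Type*} [Group G] {S : Set G} (hS : Subgroup.closure S = ⊤) (g : G) :
    ∃ w : List G, w.length = wordLength S g ∧ (∀ x ∈ w, x ∈ S ∨ x⁻¹ ∈ S) ∧ w.prod = g :=
  Nat.sInf_mem (wl_set_nonempty hS g)

lemma finite_pow_aux {G : Type*} [Group G] {A : Set G} (hA : A.Finite) (m : ℕ) :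
    (A ^ m).Finite := by
  induction m with
  | zero => simp
  | succ m ih => rw [pow_succ]; exact ih.mul hA

lemma wl_ball_finite {G : Type*} [Group G] {S : Set G} (hSf : S.Finite)
    (hS : Subgroup.closure S = ⊤) (m : ℕ) : {g : G | wordLength S g ≤ m}.Finite := by
  have hA : (insert 1 (S ∪ S⁻¹) : Set G).Finite := (hSf.union hSf.inv).insert 1
  refine (finite_pow_aux hA m).subset ?_
  intro g hg
  obtain ⟨w, hl, hw, hp⟩ := wl_spec hS g
  have key : ∀ w : List G, (∀ x ∈ w, x ∈ S ∨ x⁻¹ ∈ S) →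
      w.prod ∈ (insert 1 (S ∪ S⁻¹) : Set G) ^ w.length := by
    intro w
    induction w with
    | nil => intro _; simp
    | cons a w ih =>
      intro h
      rw [List.prod_cons, List.length_cons, pow_succ']
      refine Set.mul_mem_mul ?_ (ih fun x hx => h x (List.mem_cons_of_mem _ hx))
      right
      simpa using h a List.mem_cons_self
  have h1 := key w hw
  rw [hp, hl] at h1
  exact Set.pow_subset_pow_right (Set.mem_insert _ _) hg h1

lemma wl_gen_le {G : Type*} [Group G] {S : Set G} {s : G} (hs : s ∈ S ∨ s⁻¹ ∈ S) :
    wordLength S s ≤ 1 :=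
  Nat.sInf_le ⟨[s], rfl, by simpa using hs, by simp⟩

lemma wl_eq_zero {G : Type*} [Group G] {S : Set G} (hS : Subgroup.closure S = ⊤) {g : G}
    (h : wordLength S g = 0) : g = 1 := by
  obtain ⟨w, hl, hw, hp⟩ := wl_spec hS g
  rw [h, List.length_eq_zero_iff] at hl
  subst hl
  simpa using hp.symm

lemma setDist_attained {G : Type*} [Group G] (S : Set G) (F : Finset G) (hF : F.Nonempty) (x : G) :
    ∃ a ∈ F, setDist S x (F : Set G) = wordDist S x a := by
  have hne : ((fun a => wordDist S x a) '' (F : Set G)).Nonempty :=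
    (Finset.coe_nonempty.2 hF).image _
  have := hne.csInf_mem (F.finite_toSet.image _)
  obtain ⟨a, ha, h⟩ := this
  exact ⟨a, ha, h.symm⟩

lemma boundary_finite {G : Type*} [Group G] {S : Set G} (hSf : S.Finite)
    (hS : Subgroup.closure S = ⊤) (F : Finset G) (hF : F.Nonempty) :
    (wordBoundary S (F : Set G)).Finite := by
  refine (F.finite_toSet.mul (wl_ball_finite hSf hS 1).inv).subset ?_
  rintro x ⟨-, hx⟩
  obtain ⟨a, ha, h⟩ := setDist_attained S F hF x
  rw [h, wordDist] at hx
  refine ⟨a, ha, a⁻¹ * x, ?_, by group⟩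
  have : wordLength S (x⁻¹ * a) ≤ 1 := by exact_mod_cast hx
  simpa using this

lemma gen_mem_boundary {G : Type*} [Group G] {S : Set G}
    (hS : Subgroup.closure S = ⊤) (F : Finset G) {f s : G} (hf : f ∈ F) (hs : s ∈ S)
    (hfs : f * s ∉ F) : f * s ∈ wordBoundary S (F : Set G) := by
  obtain ⟨a, ha, h⟩ := setDist_attained S F ⟨f, hf⟩ (f * s)
  constructor
  · rw [h, wordDist]
    by_contra hc
    have h0 : wordLength S ((f * s)⁻¹ * a) = 0 := by
      by_contra h0
      exact hc (by exact_mod_cast Nat.pos_of_ne_zero h0)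
    have := wl_eq_zero hS h0
    rw [inv_mul_eq_one] at this
    exact hfs (this ▸ ha)
  · have h1 : setDist S (f * s) (F : Set G) ≤ wordDist S (f * s) f := by
      refine csInf_le ?_ ⟨f, hf, rfl⟩
      exact (F.finite_toSet.image _).bddBelow
    refine h1.trans ?_
    have : wordLength S ((f * s)⁻¹ * f) ≤ 1 := wl_gen_le (by right; simpa using hs)
    rw [wordDist]
    exact_mod_cast this

open scoped Classical in
lemma translate_bound {G : Type*} [Group G] {S : Set G} (hSf : S.Finite)
    (hS : Subgroup.closure S = ⊤) (b : G) :
    ∃ C : ℕ, ∀ F : Finset G, F.Nonempty →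
      (F.image (· * b) \ F).card ≤ C * (wordBoundary S (F : Set G)).ncard := by
  have hb : b ∈ Subgroup.closure S := by rw [hS]; trivial
  induction hb using Subgroup.closure_induction with
  | mem s hs =>
    refine ⟨1, fun F hF => ?_⟩
    rw [one_mul, ← Set.ncard_coe_finset]
    refine Set.ncard_le_ncard ?_ (boundary_finite hSf hS F hF)
    intro x hx
    simp only [Finset.coe_sdiff, Finset.coe_image, Set.mem_sdiff, Set.mem_image,
      Finset.mem_coe] at hx
    obtain ⟨⟨f, hf, rfl⟩, hx⟩ := hx
    exact gen_mem_boundary hS F hf hs hx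
  | one => exact ⟨0, fun F _ => by simp⟩
  | mul b c _ _ hb hc =>
    obtain ⟨C, hC⟩ := hb
    obtain ⟨D, hD⟩ := hc
    refine ⟨C + D, fun F hF => ?_⟩
    have hsub : F.image (· * (b * c)) \ F ⊆
        (F.image (· * b) \ F).image (· * c) ∪ (F.image (· * c) \ F) := by
      intro x hx
      simp only [Finset.mem_sdiff, Finset.mem_image, Finset.mem_union] at hx ⊢
      obtain ⟨⟨f, hf, rfl⟩, hx⟩ := hx
      by_cases h : f * b ∈ F
      · exact Or.inr ⟨⟨f * b, h, by group⟩, hx⟩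
      · exact Or.inl ⟨f * b, ⟨⟨f, hf, rfl⟩, h⟩, by group⟩
    calc _ ≤ _ := Finset.card_le_card hsub
      _ ≤ _ := Finset.card_union_le _ _
      _ ≤ _ := add_le_add (Finset.card_image_le.trans (hC F hF)) (hD F hF)
      _ = _ := by ring
  | inv b _ hb =>
    obtain ⟨C, hC⟩ := hb
    refine ⟨C, fun F hF => le_trans ?_ (hC F hF)⟩
    have h1 : (F.image (· * b)).card = F.card :=
      Finset.card_image_of_injective _ (mul_left_injective b)
    have h2 := Finset.card_sdiff_add_card_inter (F.image (· * b)) F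
    have h3 := Finset.card_sdiff_add_card_inter F (F.image (· * b))
    rw [Finset.inter_comm] at h3
    have h4 : (F.image (· * b⁻¹) \ F).card ≤ (F \ F.image (· * b)).card := by
      refine Finset.card_le_card_of_injOn (· * b) ?_ (mul_left_injective b).injOn
      intro x hx
      simp only [Finset.coe_sdiff, Finset.coe_image, Set.mem_sdiff, Set.mem_image,
        Finset.mem_coe] at hx ⊢
      obtain ⟨⟨f, hf, rfl⟩, hx⟩ := hx
      refine ⟨by simpa using hf, ?_⟩
      rintro ⟨y, hy, h⟩
      exact hx (by rw [← mul_right_cancel h]; exact hy)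
    omega

open scoped Classical in
lemma mul_bound {G : Type*} [Group G] {S : Set G} (hSf : S.Finite)
    (hS : Subgroup.closure S = ⊤) (B : Finset G) :
    ∃ C : ℕ, ∀ F : Finset G, F.Nonempty →
      (F * B).card ≤ F.card + C * (wordBoundary S (F : Set G)).ncard := by
  choose C hC using translate_bound hSf hS
  refine ⟨∑ b ∈ B, C b, fun F hF => ?_⟩
  have hsub : F * B ⊆ F ∪ B.biUnion (fun b => F.image (· * b) \ F) := by
    intro x hx
    obtain ⟨f, hf, b, hb, rfl⟩ := Finset.mem_mul.1 hx
    by_cases h : f * b ∈ F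
    · exact Finset.mem_union_left _ h
    · refine Finset.mem_union_right _ (Finset.mem_biUnion.2 ⟨b, hb, ?_⟩)
      exact Finset.mem_sdiff.2 ⟨Finset.mem_image.2 ⟨f, hf, rfl⟩, h⟩
  calc _ ≤ _ := Finset.card_le_card hsub
    _ ≤ _ := Finset.card_union_le _ _
    _ ≤ _ := add_le_add le_rfl (Finset.card_biUnion_le.trans
      (Finset.sum_le_sum fun b _ => hC b F hF))
    _ = _ := by rw [Finset.sum_mul]

open scoped Classical in
/-- If `p |F| ≤ q |F B|` for all finite `F`, then `p ≤ q`. -/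
lemma le_of_folner {G : Type*} [Group G] {S : Set G} (hSf : S.Finite)
    (hS : Subgroup.closure S = ⊤) (hG : ∃ F : ℕ → Finset G, IsFolner S F)
    (B : Finset G) (p q : ℕ) (h : ∀ F : Finset G, p * F.card ≤ q * (F * B).card) : p ≤ q := by
  obtain ⟨F, hne, hlim⟩ := hG
  obtain ⟨C, hC⟩ := mul_bound hSf hS B
  have h1 : Tendsto (fun i => (q : ℝ) + q * C *
      (((wordBoundary S ((F i : Set G))).ncard : ℝ) / ((F i).card : ℝ))) atTop
      (nhds (q + q * C * 0)) := (hlim.const_mul _).const_add _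
  rw [mul_zero, add_zero] at h1
  have h2 : (p : ℝ) ≤ q := by
    refine ge_of_tendsto' h1 fun i => ?_
    have hpos : (0 : ℝ) < (F i).card := by exact_mod_cast (hne i).card_pos
    have h3 : p * (F i).card ≤ q * ((F i).card + C * (wordBoundary S (F i : Set G)).ncard) :=
      (h (F i)).trans (Nat.mul_le_mul_left _ (hC _ (hne i)))
    have h4 : (p : ℝ) * (F i).card ≤
      q * ((F i).card + C * (wordBoundary S (F i : Set G)).ncard) := by exact_mod_cast h3
    rw [← mul_le_mul_iff_left₀ hpos]
    refine h4.trans (le_of_eq ?_)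
    field_simp
  exact_mod_cast h2

lemma exists_split {H G : Type*} [Group H] [Group G] (φ : H →* G) :
    ∃ e : H ≃ φ.range × φ.ker, ∀ h, ((e h).1 : G) = φ h := by
  have hs : ∀ r : φ.range, ∃ h, φ h = r := fun r => r.2
  choose σ hσ using hs
  refine ⟨⟨fun h => (⟨φ h, h, rfl⟩, ⟨(σ ⟨φ h, h, rfl⟩)⁻¹ * h, ?_⟩),
    fun p => σ p.1 * p.2, ?_, ?_⟩, ?_⟩
  · simp [MonoidHom.mem_ker, hσ]
  · intro h; simp
  · rintro ⟨r, κ, hκ⟩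
    have : φ (σ r * κ) = r := by rw [map_mul, hσ, MonoidHom.mem_ker.1 hκ, mul_one]
    have h2 : (⟨φ (σ r * κ), _, rfl⟩ : φ.range) = r := Subtype.ext this
    ext
    · exact this
    · simp only [h2]
      group
  · intro h; rfl

lemma backward {H G : Type*} [Group H] [Group G] (S : Set G) (φ : H →* G) (k : ℕ) (hk : 0 < k)
    (hindex : φ.range.index = k) (hker : Nat.card φ.ker = k) :
    ∃ b : H → G, Function.Bijective b ∧ ∃ M : ℝ, ∀ h : H, wordDist S (φ h) (b h) ≤ M := by
  obtain ⟨e, he⟩ := exists_split φ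
  have hfk : Finite φ.ker := Nat.finite_of_card_ne_zero (by omega)
  have hfq : Finite (G ⧸ φ.range) := Nat.finite_of_card_ne_zero (by
    change φ.range.index ≠ 0; omega)
  have hcard : Nat.card φ.ker = Nat.card (G ⧸ φ.range) := by
    rw [hker]; exact hindex.symm
  let τ : φ.ker ≃ G ⧸ φ.range := Classical.choice (Finite.card_eq.1 hcard)
  refine ⟨fun h => φ h * ((τ (e h).2).out)⁻¹, ⟨?_, ?_⟩, ?_⟩
  · intro h h' hh
    simp only at hh
    have h1 : ((τ (e h).2).out) * (φ h)⁻¹ = ((τ (e h').2).out) * (φ h')⁻¹ := by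
      simpa using congrArg (·⁻¹) hh
    have h2 : τ (e h).2 = τ (e h').2 := by
      have h3 := congrArg (fun x : G => (x : G ⧸ φ.range)) h1
      rw [QuotientGroup.mk_mul_of_mem _ (φ.range.inv_mem ⟨h, rfl⟩),
        QuotientGroup.mk_mul_of_mem _ (φ.range.inv_mem ⟨h', rfl⟩)] at h3
      simpa using h3
    apply e.injective
    refine Prod.ext (Subtype.ext ?_) (τ.injective h2)
    rw [he, he]
    rw [h2] at hh
    exact mul_right_cancel hh
  · intro g
    have hm : g * ((g⁻¹ : G) : G ⧸ φ.range).out ∈ φ.range := by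
      have := QuotientGroup.out_eq' ((g⁻¹ : G) : G ⧸ φ.range)
      have := QuotientGroup.eq.1 this.symm
      simpa using this
    refine ⟨e.symm (⟨_, hm⟩, τ.symm ((g⁻¹ : G) : G ⧸ φ.range)), ?_⟩
    simp only [← he]
    simp
  · obtain ⟨M, hM⟩ := (Set.finite_range
      (fun q : G ⧸ φ.range => (wordLength S (q.out)⁻¹ : ℝ))).bddAbove
    refine ⟨M, fun h => hM ⟨τ (e h).2, ?_⟩⟩
    simp [wordDist]

open scoped Classical in
lemma fiber_card {H G : Type*} [Group H] [Group G] (φ : H →* G) (E : Finset G)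
    (q : G ⧸ φ.range) :
    Nat.card {h : H // q.out * φ h ∈ E} =
      Nat.card φ.ker * (E.filter (fun x : G => (x : G ⧸ φ.range) = q)).card := by
  obtain ⟨e, he⟩ := exists_split φ
  have e1 : {h : H // q.out * φ h ∈ E} ≃ {p : φ.range × φ.ker // q.out * (p.1 : G) ∈ E} :=
    e.subtypeEquiv fun h => by rw [he]
  have e2 : {p : φ.range × φ.ker // q.out * (p.1 : G) ∈ E} ≃
      φ.ker × {r : φ.range // q.out * (r : G) ∈ E} :=
    ⟨fun p => (p.1.2, ⟨p.1.1, p.2⟩), fun p => ⟨(p.2.1, p.1), p.2.2⟩, fun _ => rfl, fun _ => rfl⟩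
  have e3 : {r : φ.range // q.out * (r : G) ∈ E} ≃
      {x // x ∈ E.filter (fun x : G => (x : G ⧸ φ.range) = q)} := by
    refine ⟨fun r => ⟨q.out * r.1, ?_⟩, fun x => ⟨⟨q.out⁻¹ * x.1, ?_⟩, ?_⟩, ?_, ?_⟩
    · refine Finset.mem_filter.2 ⟨r.2, ?_⟩
      rw [QuotientGroup.mk_mul_of_mem _ r.1.2]
      simp
    · have := (Finset.mem_filter.1 x.2).2
      apply QuotientGroup.eq.1
      rw [this]; simp
    · simpa using (Finset.mem_filter.1 x.2).1
    · intro r; ext; simp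
    · intro x; ext; simp
  rw [Nat.card_congr (e1.trans e2), Nat.card_prod, Nat.card_congr e3, Nat.card_eq_finsetCard]

open scoped Classical in
lemma forward {H G : Type*} [Group H] [Group G] {S : Set G} (hSf : S.Finite)
    (hS : Subgroup.closure S = ⊤) (hG : ∃ F : ℕ → Finset G, IsFolner S F)
    (φ : H →* G) (n k : ℕ) (hn : 0 < n) (hk : 0 < k)
    (hindex : φ.range.index = n) (hker : Nat.card φ.ker = k)
    (b : H → G) (hb : Function.Bijective b) (M : ℝ)
    (hM : ∀ h : H, wordDist S (φ h) (b h) ≤ M) : n = k := by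
  have hfk : Finite φ.ker := Nat.finite_of_card_ne_zero (by omega)
  have hfq : Finite (G ⧸ φ.range) := Nat.finite_of_card_ne_zero (by
    change φ.range.index ≠ 0; omega)
  have : Fintype (G ⧸ φ.range) := Fintype.ofFinite _
  have hcq : Fintype.card (G ⧸ φ.range) = n := by
    rw [← Nat.card_eq_fintype_card]; exact hindex
  let B : Finset G := (wl_ball_finite hSf hS ⌊M⌋₊).toFinset
  have hB : ∀ h, (φ h)⁻¹ * b h ∈ B := by
    intro h
    simp only [B, Set.Finite.mem_toFinset, Set.mem_ofPred_eq]
    exact Nat.le_floor (hM h)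
  have hsum : ∀ F : Finset G, ∑ q : G ⧸ φ.range,
      (F.filter (fun x : G => (x : G ⧸ φ.range) = q)).card = F.card := fun F =>
    (Finset.card_eq_sum_card_fiberwise (fun _ _ => Finset.mem_coe.2 (Finset.mem_univ _))).symm
  have hfin : ∀ (F : Finset G) (q : G ⧸ φ.range), Finite {h : H // q.out * φ h ∈ F} := by
    intro F q
    obtain ⟨e, he⟩ := exists_split φ
    refine Finite.of_injective (β := F × φ.ker) (fun h => (⟨_, h.2⟩, (e h.1).2)) ?_
    intro x y hxy
    simp only [Prod.mk.injEq, Subtype.mk.injEq, mul_right_inj] at hxy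
    refine Subtype.ext (e.injective (Prod.ext (Subtype.ext ?_) hxy.2))
    rw [he, he]; exact hxy.1
  apply le_antisymm
  · refine le_of_folner hSf hS hG B⁻¹ n k fun F => ?_
    have h1 : ∀ q : G ⧸ φ.range,
        F.card ≤ k * ((F * B⁻¹).filter (fun x : G => (x : G ⧸ φ.range) = q)).card := by
      intro q
      have := hfin (F * B⁻¹) q
      rw [← hker, ← fiber_card, ← Nat.card_eq_finsetCard]
      let c := Equiv.ofBijective b hb
      have hc : ∀ y, b (c.symm y) = y := fun y => c.apply_symm_apply y
      refine Nat.card_le_card_of_injective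
        (fun x : F => (⟨c.symm (q.out⁻¹ * x), ?_⟩ : {h : H // q.out * φ h ∈ F * B⁻¹})) ?_
      · have h2 := hB (c.symm (q.out⁻¹ * x))
        rw [hc] at h2
        have h3 := Finset.mul_mem_mul x.2 (Finset.inv_mem_inv h2)
        convert h3 using 1
        group
      · intro x y hxy
        exact Subtype.ext (mul_left_cancel (c.symm.injective (congrArg Subtype.val hxy)))
    calc n * F.card = ∑ q : G ⧸ φ.range, F.card := by simp [hcq]
      _ ≤ _ := Finset.sum_le_sum fun q _ => h1 q
      _ = _ := by rw [← Finset.mul_sum, hsum]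
  · refine le_of_folner hSf hS hG B k n fun F => ?_
    have h1 : ∀ q : G ⧸ φ.range,
        k * (F.filter (fun x : G => (x : G ⧸ φ.range) = q)).card ≤ (F * B).card := by
      intro q
      rw [← hker, ← fiber_card, ← Nat.card_eq_finsetCard]
      refine Nat.card_le_card_of_injective
        (fun h : {h : H // q.out * φ h ∈ F} => (⟨q.out * b h.1, ?_⟩ : {x // x ∈ F * B})) ?_
      · have h3 := Finset.mul_mem_mul h.2 (hB h.1)
        convert h3 using 1
        group
      · intro x y hxy
        simp only [Subtype.mk.injEq, mul_right_inj] at hxy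
        exact Subtype.ext (hb.1 hxy)
    calc k * F.card = ∑ q : G ⧸ φ.range, k * (F.filter (fun x : G => (x : G ⧸ φ.range) = q)).card := by
          rw [← Finset.mul_sum, hsum]
      _ ≤ ∑ q : G ⧸ φ.range, (F * B).card := Finset.sum_le_sum fun q _ => h1 q
      _ = _ := by simp [hcq]

/-- A homomorphism `φ : H → G` of finitely generated amenable groups with
image of finite index `n` and finite kernel of cardinality `k` is a bounded distance from a
bijection (w.r.t. the word metric on `G`) if and only if `n = k`. -/
theorem homomorphism_bounded_distance_from_bijection_iff
    {H G : Type*} [Group H] [Group G]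
    (T : Set H) (hTfin : T.Finite) (hTgen : Subgroup.closure T = ⊤)
    (hHamen : ∃ F : ℕ → Finset H, IsFolner T F)
    (S : Set G) (hSfin : S.Finite) (hSgen : Subgroup.closure S = ⊤)
    (hGamen : ∃ F : ℕ → Finset G, IsFolner S F)
    (φ : H →* G) (n k : ℕ) (hn : 0 < n) (hk : 0 < k)
    (hindex : φ.range.index = n)
    (hker : Nat.card φ.ker = k) :
    (∃ b : H → G, Function.Bijective b ∧ ∃ M : ℝ, ∀ h : H, wordDist S (φ h) (b h) ≤ M)
      ↔ n = k := by
  constructor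
  · rintro ⟨b, hb, M, hM⟩
    exact forward hSfin hSgen hGamen φ n k hn hk hindex hker b hb M hM
  · rintro rfl
    exact backward S φ n hn hindex hker
end

section
/- Let G and H be finitely generated non-amenable groups, each equipped with a word metric. Then every quasi-isometry f : G → H is a bounded distance from a bijection; that is, there exists a bijection b : G → H with sup_{g ∈ G} d(f(g), b(g)) < ∞. -/
open Filter

lemma wl_exists {G : Type*} [Group G] (S : Set G) (h : Subgroup.closure S = ⊤) (g : G) :
    ∃ w : List G, w.length = wordLength S g ∧ (∀ x ∈ w, x ∈ S ∨ x⁻¹ ∈ S) ∧ w.prod = g := by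
  have hg : g ∈ Subgroup.closure S := by rw [h]; trivial
  rw [← Subgroup.mem_toSubmonoid, Subgroup.closure_toSubmonoid] at hg
  obtain ⟨l, hl, hp⟩ := Submonoid.exists_list_of_mem_closure hg
  have : {n : ℕ | ∃ w : List G, w.length = n ∧ (∀ x ∈ w, x ∈ S ∨ x⁻¹ ∈ S) ∧ w.prod = g}.Nonempty :=
    ⟨l.length, l, rfl, hl, hp⟩
  exact Nat.sInf_mem this

lemma wl_le {G : Type*} [Group G] (S : Set G) (w : List G) (hw : ∀ x ∈ w, x ∈ S ∨ x⁻¹ ∈ S) :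
    wordLength S w.prod ≤ w.length :=
  Nat.sInf_le ⟨w, rfl, hw, rfl⟩

lemma wl_one {G : Type*} [Group G] (S : Set G) : wordLength S (1 : G) = 0 := by
  have := wl_le S [] (by simp)
  simpa using this

lemma wl_mul {G : Type*} [Group G] (S : Set G) (h : Subgroup.closure S = ⊤) (a b : G) :
    wordLength S (a * b) ≤ wordLength S a + wordLength S b := by
  obtain ⟨u, hu, hu', hup⟩ := wl_exists S h a
  obtain ⟨v, hv, hv', hvp⟩ := wl_exists S h b
  have := wl_le S (u ++ v) (by
    intro x hx
    rcases List.mem_append.1 hx with hx | hx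
    · exact hu' x hx
    · exact hv' x hx)
  rw [List.prod_append, hup, hvp, List.length_append, hu, hv] at this
  exact this

lemma wl_inv_le {G : Type*} [Group G] (S : Set G) (h : Subgroup.closure S = ⊤) (a : G) :
    wordLength S a⁻¹ ≤ wordLength S a := by
  obtain ⟨u, hu, hu', hup⟩ := wl_exists S h a
  have := wl_le S (u.map (·⁻¹)).reverse (by
    intro x hx
    simp only [List.mem_reverse, List.mem_map] at hx
    obtain ⟨y, hy, rfl⟩ := hx
    rw [inv_inv]
    exact (hu' y hy).symm)
  rw [← List.prod_inv_reverse, hup] at this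
  simpa [hu] using this

lemma wl_symm {G : Type*} [Group G] (S : Set G) (h : Subgroup.closure S = ⊤) (a b : G) :
    wordLength S (a⁻¹ * b) ≤ wordLength S (b⁻¹ * a) := by
  have := wl_inv_le S h (b⁻¹ * a)
  simpa using this

lemma wl_tri {G : Type*} [Group G] (S : Set G) (h : Subgroup.closure S = ⊤) (a b c : G) :
    wordLength S (a⁻¹ * c) ≤ wordLength S (a⁻¹ * b) + wordLength S (b⁻¹ * c) := by
  have := wl_mul S h (a⁻¹ * b) (b⁻¹ * c)
  simpa [mul_assoc] using this

lemma words_finite {G : Type*} [Group G] (S : Set G) (hS : S.Finite) (n : ℕ) :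
    {g : G | ∃ w : List G, w.length = n ∧ (∀ x ∈ w, x ∈ S ∨ x⁻¹ ∈ S) ∧ w.prod = g}.Finite := by
  induction n with
  | zero =>
    refine (Set.finite_singleton (1 : G)).subset ?_
    rintro g ⟨w, hw, -, rfl⟩
    simp [List.length_eq_zero_iff.1 hw]
  | succ n ih =>
    have hS' : {x : G | x ∈ S ∨ x⁻¹ ∈ S}.Finite :=
      hS.union (hS.preimage (inv_injective.injOn))
    refine (Set.Finite.image2 (fun a b : G => a * b) hS' ih).subset ?_
    rintro g ⟨w, hw, hw', rfl⟩
    cases w with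
    | nil => simp at hw
    | cons a w =>
      refine ⟨a, hw' a (by simp), w.prod, ⟨w, by simpa using hw, fun x hx => hw' x (by simp [hx]), rfl⟩, by simp⟩

lemma ball_finite {G : Type*} [Group G] (S : Set G) (hS : S.Finite)
    (h : Subgroup.closure S = ⊤) (n : ℕ) : {g : G | wordLength S g ≤ n}.Finite := by
  refine ((Set.finite_Iic n).biUnion (fun k _ => words_finite S hS k)).subset ?_
  intro g hg
  obtain ⟨w, hw⟩ := wl_exists S h g
  simp only [Set.mem_iUnion]
  exact ⟨wordLength S g, hg, w, hw⟩

open Classical in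
/-- The closed `n`-neighbourhood of a finite set. -/
noncomputable def nbhd {G : Type*} [Group G] (S : Set G) (hS : S.Finite)
    (h : Subgroup.closure S = ⊤) (n : ℕ) (A : Finset G) : Finset G :=
  A.biUnion fun a => (ball_finite S hS h n).toFinset.image (fun g => a * g)

lemma mem_nbhd {G : Type*} [Group G] (S : Set G) (hS : S.Finite)
    (h : Subgroup.closure S = ⊤) (n : ℕ) (A : Finset G) (x : G) :
    x ∈ nbhd S hS h n A ↔ ∃ a ∈ A, wordLength S (a⁻¹ * x) ≤ n := by
  classical
  simp only [nbhd, Finset.mem_biUnion, Finset.mem_image, Set.Finite.mem_toFinset, Set.mem_ofPred_eq]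
  constructor
  · rintro ⟨a, ha, g, hg, rfl⟩
    exact ⟨a, ha, by simpa using hg⟩
  · rintro ⟨a, ha, hx⟩
    exact ⟨a, ha, _, hx, by simp⟩

lemma exists_eps {G : Type*} [Group G] (S : Set G)
    (hna : ¬ ∃ F : ℕ → Finset G, IsFolner S F) :
    ∃ ε : ℝ, 0 < ε ∧ ∀ A : Finset G, A.Nonempty →
      ε * A.card ≤ ((wordBoundary S (A : Set G)).ncard : ℝ) := by
  by_contra! hc
  choose! F hF using hc
  apply hna
  have hpos : ∀ i : ℕ, (0 : ℝ) < 1 / ((i : ℝ) + 1) := fun i => by positivity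
  refine ⟨fun i => F (1 / ((i : ℝ) + 1)), fun i => (hF _ (hpos i)).1, ?_⟩
  refine squeeze_zero (fun i => by positivity) (fun i => ?_) tendsto_one_div_add_atTop_nhds_zero_nat
  obtain ⟨hne, hlt⟩ := hF _ (hpos i)
  have : (0 : ℝ) < (F (1 / ((i : ℝ) + 1))).card := by exact_mod_cast hne.card_pos
  rw [div_le_iff₀ this]
  exact hlt.le

lemma boundary_card {G : Type*} [Group G] (S : Set G) (hS : S.Finite)
    (h : Subgroup.closure S = ⊤) (A : Finset G) (hA : A.Nonempty) :
    A.card + (wordBoundary S (A : Set G)).ncard ≤ (nbhd S hS h 1 A).card := by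
  classical
  have hbdd : ∀ x : G, BddBelow ((fun a => wordDist S x a) '' (A : Set G)) := by
    intro x
    refine ⟨0, ?_⟩
    rintro _ ⟨a, -, rfl⟩
    exact Nat.cast_nonneg _
  have hsub : wordBoundary S (A : Set G) ⊆ ((nbhd S hS h 1 A : Finset G) : Set G) := by
    rintro x ⟨-, hx⟩
    have hm := (hA.to_set.image (fun a => wordDist S x a)).csInf_mem (A.finite_toSet.image _)
    obtain ⟨a, ha, hax⟩ := hm
    have hax' : wordDist S x a ≤ 1 := by
      have : wordDist S x a = setDist S x A := hax
      rw [this]; exact hx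
    have h1 : wordLength S (x⁻¹ * a) ≤ 1 := by
      unfold wordDist at hax'; exact_mod_cast hax'
    rw [Finset.mem_coe, mem_nbhd]
    exact ⟨a, ha, (wl_symm S h a x).trans h1⟩
  have hdisj : Disjoint (A : Set G) (wordBoundary S (A : Set G)) := by
    rw [Set.disjoint_left]
    rintro x hx ⟨hx0, -⟩
    have : setDist S x A ≤ wordDist S x x := csInf_le (hbdd x) ⟨x, hx, rfl⟩
    simp only [wordDist, inv_mul_cancel, wl_one, Nat.cast_zero] at this
    linarith
  have hfin : (wordBoundary S (A : Set G)).Finite := (Finset.finite_toSet _).subset hsub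
  have hu := Set.ncard_union_eq hdisj A.finite_toSet hfin
  rw [Set.ncard_coe_finset] at hu
  rw [← hu, ← Set.ncard_coe_finset]
  refine Set.ncard_le_ncard (Set.union_subset ?_ hsub) (Finset.finite_toSet _)
  intro x hx
  rw [Finset.mem_coe, mem_nbhd]
  exact ⟨x, hx, by simp [wl_one]⟩

lemma nbhd_nonempty {G : Type*} [Group G] (S : Set G) (hS : S.Finite)
    (h : Subgroup.closure S = ⊤) (n : ℕ) (A : Finset G) (hA : A.Nonempty) :
    (nbhd S hS h n A).Nonempty := by
  obtain ⟨a, ha⟩ := hA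
  exact ⟨a, (mem_nbhd S hS h n A a).2 ⟨a, ha, by simp [wl_one]⟩⟩

lemma growth {G : Type*} [Group G] (S : Set G) (hS : S.Finite)
    (h : Subgroup.closure S = ⊤) (hna : ¬ ∃ F : ℕ → Finset G, IsFolner S F) :
    ∃ ε : ℝ, 0 < ε ∧ ∀ (n : ℕ) (A : Finset G), A.Nonempty →
      (1 + ε) ^ n * A.card ≤ ((nbhd S hS h n A).card : ℝ) := by
  obtain ⟨ε, hε, H⟩ := exists_eps S hna
  refine ⟨ε, hε, fun n A hA => ?_⟩
  induction n with
  | zero =>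
    rw [pow_zero, one_mul, Nat.cast_le]
    refine Finset.card_le_card fun a ha => (mem_nbhd S hS h 0 A a).2 ⟨a, ha, by simp [wl_one]⟩
  | succ n ih =>
    have hB := nbhd_nonempty S hS h n A hA
    have h1 := H _ hB
    have h2 : ((nbhd S hS h n A).card : ℝ) +
        ((wordBoundary S ((nbhd S hS h n A : Finset G) : Set G)).ncard : ℝ)
        ≤ ((nbhd S hS h 1 (nbhd S hS h n A)).card : ℝ) := by
      exact_mod_cast boundary_card S hS h _ hB
    have h3 : ((nbhd S hS h 1 (nbhd S hS h n A)).card : ℝ) ≤ ((nbhd S hS h (n + 1) A).card : ℝ) := by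
      rw [Nat.cast_le]
      refine Finset.card_le_card fun x hx => ?_
      rw [mem_nbhd] at hx ⊢
      obtain ⟨b, hb, hbx⟩ := hx
      rw [mem_nbhd] at hb
      obtain ⟨a, ha, hab⟩ := hb
      exact ⟨a, ha, (wl_tri S h a b x).trans (add_le_add hab hbx)⟩
    calc (1 + ε) ^ (n + 1) * (A.card : ℝ) = (1 + ε) * ((1 + ε) ^ n * A.card) := by ring
      _ ≤ (1 + ε) * ((nbhd S hS h n A).card : ℝ) := by gcongr
      _ ≤ _ := by linarith

lemma exists_near_injection {G H : Type*} [Group G] [Group H]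
    (S : Set G) (hS : S.Finite) (hSg : Subgroup.closure S = ⊤)
    (T : Set H) (hT : T.Finite) (hTg : Subgroup.closure T = ⊤)
    (hna : ¬ ∃ F : ℕ → Finset H, IsFolner T F)
    (f : G → H) (R : ℕ) (hf : ∀ x y, f x = f y → wordLength S (x⁻¹ * y) ≤ R) :
    ∃ (n : ℕ) (φ : G → H), Function.Injective φ ∧
      ∀ x, wordLength T ((f x)⁻¹ * φ x) ≤ n := by
  classical
  obtain ⟨ε, hε, hgr⟩ := growth T hT hTg hna
  set D : ℕ := (ball_finite S hS hSg R).toFinset.card with hD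
  obtain ⟨n, hn⟩ := pow_unbounded_of_one_lt (D : ℝ) (by linarith : 1 < 1 + ε)
  refine ⟨n, ?_⟩
  have hall := (Finset.all_card_le_biUnion_card_iff_exists_injective
    (fun x : G => nbhd T hT hTg n {f x})).1 ?_
  · obtain ⟨φ, hφ, hm⟩ := hall
    refine ⟨φ, hφ, fun x => ?_⟩
    have := hm x
    rw [mem_nbhd] at this
    simpa using this
  · intro A
    rcases A.eq_empty_or_nonempty with rfl | hA
    · simp
    have h1 : A.card ≤ D * (A.image f).card := by
      refine Finset.card_le_mul_card_image A D ?_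
      intro b hb
      obtain ⟨a, ha, rfl⟩ := Finset.mem_image.1 hb
      rw [hD, ← Finset.card_image_of_injective (ball_finite S hS hSg R).toFinset
        (mul_right_injective a)]
      refine Finset.card_le_card fun x hx => ?_
      rw [Finset.mem_filter] at hx
      refine Finset.mem_image.2 ⟨a⁻¹ * x, ?_, by simp⟩
      rw [Set.Finite.mem_toFinset]
      exact hf a x hx.2.symm
    have h2 := hgr n (A.image f) (hA.image f)
    have h3 : nbhd T hT hTg n (A.image f) ⊆ A.biUnion (fun x : G => nbhd T hT hTg n {f x}) := by
      intro y hy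
      rw [mem_nbhd] at hy
      obtain ⟨b, hb, hby⟩ := hy
      obtain ⟨a, ha, rfl⟩ := Finset.mem_image.1 hb
      rw [Finset.mem_biUnion]
      exact ⟨a, ha, (mem_nbhd _ _ _ _ _ _).2 ⟨f a, by simp, hby⟩⟩
    refine le_trans ?_ (Finset.card_le_card h3)
    have h1' : (A.card : ℝ) ≤ D * ((A.image f).card : ℝ) := by exact_mod_cast h1
    have h4 : (D : ℝ) * ((A.image f).card : ℝ) ≤ (1 + ε) ^ n * ((A.image f).card : ℝ) := by gcongr
    exact_mod_cast h1'.trans (h4.trans h2)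

/-- **Whyte.** Any quasi-isometry between finitely generated non-amenable groups
(each with a word metric) is a bounded distance from a bijection. -/
theorem quasiIsometry_nonamenable_bounded_distance_from_bijection
    {G H : Type*} [Group G] [Group H]
    (S : Set G) (hSfin : S.Finite) (hSgen : Subgroup.closure S = ⊤)
    (T : Set H) (hTfin : T.Finite) (hTgen : Subgroup.closure T = ⊤)
    (hGna : ¬ ∃ F : ℕ → Finset G, IsFolner S F)
    (hHna : ¬ ∃ F : ℕ → Finset H, IsFolner T F)
    (f : G → H) (hf : IsQuasiIsometry (wordDist S) (wordDist T) f) :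
    ∃ b : G → H, Function.Bijective b ∧ ∃ M : ℝ, ∀ g : G, wordDist T (f g) (b g) ≤ M := by
  obtain ⟨K, C, hK, hC, hq, hd⟩ := hf
  have hK0 : 0 < K := by linarith
  have tri : ∀ a b c : H, wordDist T a c ≤ wordDist T a b + wordDist T b c := by
    intro a b c
    unfold wordDist
    exact_mod_cast wl_tri T hTgen a b c
  have symm : ∀ a b : H, wordDist T a b ≤ wordDist T b a := by
    intro a b
    unfold wordDist
    exact_mod_cast wl_symm T hTgen a b
  choose g hg using hd
  obtain ⟨n, φ, hφ, hφn⟩ := exists_near_injection S hSfin hSgen T hTfin hTgen hHna f ⌈K * C⌉₊ (by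
    intro x y hxy
    have h1 := (hq x y).1
    have h2 : wordDist T (f x) (f y) = 0 := by
      rw [hxy]; simp [wordDist, wl_one]
    have h3 : wordDist S x y / K ≤ C := by linarith
    rw [div_le_iff₀ hK0] at h3
    have h4 : (wordLength S (x⁻¹ * y) : ℝ) ≤ (⌈K * C⌉₊ : ℝ) := by
      refine le_trans ?_ (Nat.le_ceil _)
      unfold wordDist at h3
      linarith
    exact_mod_cast h4)
  obtain ⟨m, ψ, hψ, hψm⟩ := exists_near_injection T hTfin hTgen S hSfin hSgen hGna g ⌈2 * C⌉₊ (by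
    intro x y hxy
    have h1 := tri x (f (g x)) y
    have h2 := symm x (f (g x))
    have h3 := hg x
    have h5 := hg y
    rw [← hxy] at h5
    have h4 : (wordLength T (x⁻¹ * y) : ℝ) ≤ (⌈2 * C⌉₊ : ℝ) := by
      refine le_trans ?_ (Nat.le_ceil _)
      change wordDist T x y ≤ _
      linarith
    exact_mod_cast h4)
  obtain ⟨b, hb, hbM⟩ := Function.Embedding.schroeder_bernstein_of_rel hφ hψ
    (fun x y => wordDist T (f x) y ≤ max (n : ℝ) (K * m + C + C)) (by
      intro x
      refine le_trans ?_ (le_max_left _ _)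
      unfold wordDist
      exact_mod_cast hφn x) (by
      intro y
      refine le_trans ?_ (le_max_right _ _)
      have h1 := tri (f (ψ y)) (f (g y)) y
      have h2 := hg y
      have h3 := symm (f (ψ y)) (f (g y))
      have h4 := (hq (g y) (ψ y)).2
      have h5 : wordDist S (g y) (ψ y) ≤ m := by
        unfold wordDist
        exact_mod_cast hψm y
      have h6 : K * wordDist S (g y) (ψ y) ≤ K * m := by gcongr
      linarith)
  exact ⟨b, hb, _, hbM⟩
end
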